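/- Let G_n ~ PAPER(α, β, θ) with α = 1, β = 0 (uniform attachment tree plus Erdős–Rényi(θ) noise), and suppose θ = o(log n / n). Let D_{G_n}(t) be the degree in G_n of the node with arrival time t and let k-max(D_{G_n}) be the k-th largest degree. For η ∈ (0,1), define L_{η,n,ε} := n^η + ε^{−1} n^{1 − (2−η)·h(η/(2−η))}, where h(x) = (1+x)log(1+x) − x. Then: (i) for every ε ∈ (0,1) and η ∈ (0,1), limsup_{n→∞} P( D_{G_n}(1) ≤ L_{η,n,ε}-max(D_{G_n}) ) ≤ ε; (ii) consequently there exists γ ≤ 0.8 such that for every ε ∈ (0,1), n^{−γ} ε^{−1} |B_ε(G*_n)| = O_p(1). -/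

import Mathlib

open scoped Classical
open Finset

noncomputable section

/-- A parent map encoding a recursive tree on `Fin n` (nodes indexed by arrival
time, `0`-indexed): node `0` is the root, and every node `t ≠ 0` attaches to the
earlier node `pa t`. -/
def IsParentMap {n : ℕ} (pa : Fin n → Fin n) : Prop :=
  (∀ t : Fin n, t.val = 0 → pa t = t) ∧ ∀ t : Fin n, t.val ≠ 0 → (pa t).val < t.val

/-- Degree of node `w` in the tree grown on the nodes `0, …, t`. -/
def degAt {n : ℕ} (pa : Fin n → Fin n) (t : ℕ) (w : Fin n) : ℕ :=
  (Finset.univ.filter (fun s : Fin n => 1 ≤ s.val ∧ s.val ≤ t ∧ pa s = w)).card +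
    (if w.val ≠ 0 ∧ w.val ≤ t then 1 else 0)

/-- Probability that the affine preferential attachment process `APA(α,β)`
produces the recursive tree encoded by `pa`: the product over arrival times of
the attachment probabilities `(β·deg + α) / (2·#edges·β + #nodes·α)`. -/
def apaProb {n : ℕ} (α β : ℝ) (pa : Fin n → Fin n) : ℝ :=
  ∏ t : Fin n,
    if 2 ≤ t.val then
      (β * degAt pa (t.val - 1) (pa t) + α) /
        (2 * ((t.val : ℝ) - 1) * β + (t.val : ℝ) * α)
    else 1

/-- The graph of the recursive tree encoded by `pa`. -/
def treeGraph {n : ℕ} (pa : Fin n → Fin n) : SimpleGraph (Fin n) :=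
  SimpleGraph.fromRel (fun i j => j.val ≠ 0 ∧ pa j = i)

/-- The mass function of `G_n ~ PAPER(α,β,θ)`: `G_n = T_n + R_n` is the union of
an `APA(α,β)` tree and an independent Erdős–Rényi(θ) graph (multi-edges collapsed). -/
def paperProb (n : ℕ) (α β θ : ℝ) (g : SimpleGraph (Fin n)) : ℝ :=
  θ ^ (g.edgeSet.ncard - (n - 1)) * (1 - θ) ^ (n * (n - 1) / 2 - g.edgeSet.ncard) *
    ∑ pa : Fin n → Fin n,
      if IsParentMap pa ∧ treeGraph pa ≤ g then apaProb α β pa else 0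

variable {U : Type} [Fintype U] [DecidableEq U]

/-- Posterior root probability `P(Π₁ = u | Π G_n = g̃)` where `Π` is a uniformly
random bijection (relabeling) `Fin n ≃ U` independent of `G_n ~ PAPER(α,β,θ)`. -/
def postRoot (n : ℕ) [NeZero n] (α β θ : ℝ) (g : SimpleGraph U) (u : U) : ℝ :=
  (∑ π : Fin n ≃ U, if π 0 = u then paperProb n α β θ (g.comap ⇑π) else 0) /
    ∑ π : Fin n ≃ U, paperProb n α β θ (g.comap ⇑π)


/-- Degree of node `v` in the graph `g`. -/
def degOf {n : ℕ} (g : SimpleGraph (Fin n)) (v : Fin n) : ℕ :=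
  (g.neighborSet v).ncard

/-- `k-max(d)`: the `k`-th largest value of the degree sequence `d`, i.e. the
largest `x` such that at least `k` nodes have degree `≥ x`. -/
def kthMax {n : ℕ} (d : Fin n → ℕ) (k : ℕ) : ℕ :=
  sSup {x : ℕ | k ≤ (Finset.univ.filter (fun v : Fin n => x ≤ d v)).card}

/-- The size `L_ε(g̃)` of the level `1-ε` credible set `B_ε(g̃)`: the smallest
cardinality of a set of nodes of maximal posterior root probability whose
posterior root probabilities sum to at least `1-ε`.  (This size does not depend
on the tie-breaking randomization.) -/
def credSize (n : ℕ) [NeZero n] (α β θ ε : ℝ) (g : SimpleGraph (Fin n)) : ℕ :=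
  sInf {k : ℕ | ∃ s : Finset (Fin n), s.card = k ∧
    (1 - ε ≤ ∑ u ∈ s, postRoot n α β θ g u) ∧
    ∀ u ∈ s, ∀ v ∈ Finset.univ \ s, postRoot n α β θ g v ≤ postRoot n α β θ g u}


/-- `h(x) = (1+x)·log(1+x) − x`. -/
def hBennett (x : ℝ) : ℝ := (1 + x) * Real.log (1 + x) - x

/-- `L_{η,n,ε} = n^η + ε⁻¹ n^{1-(2-η)h(η/(2-η))}`. -/
def Lbound (η : ℝ) (n : ℕ) (ε : ℝ) : ℝ :=
  (n : ℝ) ^ η + ε⁻¹ * (n : ℝ) ^ (1 - (2 - η) * hBennett (η / (2 - η)))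

lemma ua_edges_card {n : ℕ} (pa : Fin n → Fin n) (hpa : IsParentMap pa) :
    (treeGraph pa).edgeFinset.card = n - 1 := by
  have himg : (treeGraph pa).edgeFinset
      = (Finset.univ.filter (fun t : Fin n => t.val ≠ 0)).image (fun t => s(pa t, t)) := by
    ext e
    induction e using Sym2.ind with
    | _ a b =>
      rw [SimpleGraph.mem_edgeFinset, SimpleGraph.mem_edgeSet]
      simp only [treeGraph,
        SimpleGraph.fromRel_adj, Finset.mem_image, Finset.mem_filter, Finset.mem_univ, true_and]
      constructor
      · rintro ⟨_, ⟨h1, h2⟩ | ⟨h1, h2⟩⟩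
        · exact ⟨b, h1, by rw [h2]⟩
        · exact ⟨a, h1, by rw [h2, Sym2.eq_swap]⟩
      · rintro ⟨t, ht, he⟩
        have hlt := hpa.2 t ht
        rw [Sym2.eq_iff] at he
        rcases he with ⟨h1, h2⟩ | ⟨h1, h2⟩
        · subst h2
          refine ⟨?_, Or.inl ⟨ht, h1⟩⟩
          rintro rfl
          rw [h1] at hlt; omega
        · subst h2
          refine ⟨?_, Or.inr ⟨ht, h1⟩⟩
          rintro rfl
          rw [h1] at hlt; omega
  rw [himg, Finset.card_image_of_injOn]
  · rcases n with _ | n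
    · simp
    · have : (Finset.univ.filter (fun t : Fin (n+1) => t.val ≠ 0)) = Finset.univ.erase 0 := by
        ext t
        simp only [Finset.mem_filter, Finset.mem_univ, true_and, Finset.mem_erase, and_true, ne_eq]
        exact not_congr Fin.val_eq_zero_iff
      rw [this, Finset.card_erase_of_mem (Finset.mem_univ _)]; simp
  · intro t ht t' ht' he
    simp only [Finset.coe_filter, Finset.mem_univ, true_and, Set.mem_ofPred_eq] at ht ht'
    have h1 := hpa.2 t ht
    have h2 := hpa.2 t' ht'
    simp only [Sym2.eq_iff] at he
    rcases he with ⟨_, h⟩ | ⟨h3, h4⟩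
    · exact h
    · rw [h3] at h1; rw [← h4] at h2; omega

lemma ua_degOf_eq {n : ℕ} (g : SimpleGraph (Fin n)) (u : Fin n) :
    degOf g u = (g.edgeFinset.filter (fun e => u ∈ e)).card := by
  rw [degOf, ← SimpleGraph.incidenceFinset_eq_filter, SimpleGraph.card_incidenceFinset_eq_degree,
    Set.ncard_eq_toFinset_card', SimpleGraph.degree, SimpleGraph.neighborFinset]

lemma ua_degOf_mono {n : ℕ} {g g' : SimpleGraph (Fin n)} (h : g ≤ g') (u : Fin n) :
    degOf g u ≤ degOf g' u :=
  Set.ncard_le_ncard (fun _ hv => h hv) (Set.toFinite _)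

/-- number of children -/
def uaCh {n : ℕ} (pa : Fin n → Fin n) (u : Fin n) : ℕ :=
  (Finset.univ.filter (fun t : Fin n => t.val ≠ 0 ∧ pa t = u)).card

lemma ua_deg_tree_le {n : ℕ} (pa : Fin n → Fin n) (u : Fin n) :
    degOf (treeGraph pa) u ≤ uaCh pa u + 1 := by
  have : (treeGraph pa).neighborSet u ⊆
      ((insert (pa u) (Finset.univ.filter (fun t : Fin n => t.val ≠ 0 ∧ pa t = u)) : Finset _) :
        Set (Fin n)) := by
    intro v hv
    simp only [SimpleGraph.mem_neighborSet, treeGraph, SimpleGraph.fromRel_adj] at hv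
    simp only [Finset.coe_insert, Finset.coe_filter, Finset.mem_univ, true_and,
      Set.mem_insert_iff, Set.mem_ofPred_eq]
    rcases hv.2 with h | h
    · exact Or.inr h
    · exact Or.inl h.2.symm
  refine (Set.ncard_le_ncard this (Finset.finite_toSet _)).trans ?_
  rw [Set.ncard_coe_finset]
  exact Finset.card_insert_le _ _

lemma ua_le_deg_tree {n : ℕ} (pa : Fin n → Fin n) (hpa : IsParentMap pa) (u : Fin n) :
    uaCh pa u ≤ degOf (treeGraph pa) u := by
  have : ((Finset.univ.filter (fun t : Fin n => t.val ≠ 0 ∧ pa t = u) : Finset _) :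
        Set (Fin n)) ⊆ (treeGraph pa).neighborSet u := by
    intro v hv
    simp only [Finset.coe_filter, Finset.mem_univ, true_and, Set.mem_ofPred_eq] at hv
    simp only [SimpleGraph.mem_neighborSet, treeGraph, SimpleGraph.fromRel_adj]
    refine ⟨?_, Or.inl hv⟩
    rintro rfl
    have := hpa.2 _ hv.1
    rw [hv.2] at this; omega
  have h := Set.ncard_le_ncard this (Set.toFinite _)
  rwa [Set.ncard_coe_finset] at h

lemma ua_er {n : ℕ} (pa : Fin n → Fin n) (hpa : IsParentMap pa) (θ : ℝ) (h0 : 0 ≤ θ) (h1 : θ ≤ 1)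
    (x : ℝ) (hx : 1 ≤ x) (u : Fin n) :
    ∑ g ∈ Finset.univ.filter (fun g : SimpleGraph (Fin n) => treeGraph pa ≤ g),
      θ ^ (g.edgeSet.ncard - (n - 1)) * (1 - θ) ^ (n * (n - 1) / 2 - g.edgeSet.ncard) *
        x ^ degOf g u ≤ x ^ degOf (treeGraph pa) u * (1 + θ * (x - 1)) ^ n := by
  set T := treeGraph pa with hT
  set C := (⊤ : SimpleGraph (Fin n)).edgeFinset \ T.edgeFinset with hC
  have hx0 : (0:ℝ) ≤ x := by linarith
  have hθ' : 0 ≤ 1 - θ := by linarith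
  have hf0 : ∀ e : Sym2 (Fin n), (0:ℝ) ≤ θ * (if u ∈ e then x else 1) := fun e => by
    split_ifs <;> positivity
  have hTc : T.edgeFinset.card = n - 1 := ua_edges_card pa hpa
  have hNc : (⊤ : SimpleGraph (Fin n)).edgeFinset.card = n * (n - 1) / 2 := by
    rw [SimpleGraph.card_edgeFinset_top_eq_card_choose_two, Fintype.card_fin, Nat.choose_two_right]
  set W : Finset (Sym2 (Fin n)) → ℝ := fun S =>
    (∏ e ∈ S, θ * (if u ∈ e then x else 1)) * ∏ e ∈ C \ S, (1 - θ) with hW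
  have hW0 : ∀ S, 0 ≤ W S := fun S =>
    mul_nonneg (Finset.prod_nonneg fun e _ => hf0 e) (Finset.prod_nonneg fun e _ => hθ')
  set F := Finset.univ.filter (fun g : SimpleGraph (Fin n) => T ≤ g) with hF
  set i : SimpleGraph (Fin n) → Finset (Sym2 (Fin n)) := fun g => g.edgeFinset \ T.edgeFinset with hi
  have hinj : Set.InjOn i (F : Set (SimpleGraph (Fin n))) := by
    intro g hg g' hg' h
    simp only [hF, Finset.coe_filter, Finset.mem_univ, true_and, Set.mem_ofPred_eq] at hg hg'
    have e1 : g.edgeFinset = i g ∪ T.edgeFinset :=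
      (Finset.sdiff_union_of_subset (SimpleGraph.edgeFinset_mono hg)).symm
    have e2 : g'.edgeFinset = i g' ∪ T.edgeFinset :=
      (Finset.sdiff_union_of_subset (SimpleGraph.edgeFinset_mono hg')).symm
    exact SimpleGraph.edgeFinset_inj.1 (by rw [e1, e2, h])
  have step1 : ∑ g ∈ F, θ ^ (g.edgeSet.ncard - (n - 1)) *
      (1 - θ) ^ (n * (n - 1) / 2 - g.edgeSet.ncard) * x ^ degOf g u
      ≤ ∑ g ∈ F, x ^ degOf T u * W (i g) := by
    refine Finset.sum_le_sum fun g hg => ?_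
    have hTg : T ≤ g := by simpa [hF] using hg
    have hsub := SimpleGraph.edgeFinset_mono hTg
    have hgN : g.edgeFinset ⊆ (⊤ : SimpleGraph (Fin n)).edgeFinset :=
      SimpleGraph.edgeFinset_mono le_top
    have hcard : g.edgeSet.ncard = g.edgeFinset.card := by
      rw [Set.ncard_eq_toFinset_card', SimpleGraph.edgeFinset]
    have c1 : (i g).card = g.edgeSet.ncard - (n - 1) := by
      rw [hcard, ← hTc, Finset.card_sdiff_of_subset hsub]
    have c2 : (C \ i g).card = n * (n - 1) / 2 - g.edgeSet.ncard := by
      have : C \ i g = (⊤ : SimpleGraph (Fin n)).edgeFinset \ g.edgeFinset := by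
        ext e
        have := @hsub e
        simp only [hC, hi, Finset.mem_sdiff]
        tauto
      rw [this, Finset.card_sdiff_of_subset hgN, hNc, hcard]
    have hd : degOf g u = degOf T u + ((i g).filter (fun e => u ∈ e)).card := by
      rw [ua_degOf_eq, ua_degOf_eq, ← Finset.card_union_of_disjoint]
      · congr 1
        rw [← Finset.filter_union, Finset.union_sdiff_of_subset hsub]
      · exact (Finset.disjoint_filter_filter (Finset.disjoint_sdiff))
    have hWi : W (i g) = θ ^ (g.edgeSet.ncard - (n - 1)) *
        x ^ ((i g).filter (fun e => u ∈ e)).card *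
        (1 - θ) ^ (n * (n - 1) / 2 - g.edgeSet.ncard) := by
      rw [hW]
      simp only
      rw [Finset.prod_mul_distrib, Finset.prod_const, Finset.prod_const, c1, c2,
        ← Finset.prod_filter, Finset.prod_const]
    rw [hWi, hd, pow_add]
    apply le_of_eq; ring
  have step2 : ∑ g ∈ F, W (i g) ≤ ∑ S ∈ C.powerset, W S := by
    rw [← Finset.sum_image (f := W) hinj]
    refine Finset.sum_le_sum_of_subset_of_nonneg ?_ fun S _ _ => hW0 S
    intro S hS
    obtain ⟨g, _, rfl⟩ := Finset.mem_image.1 hS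
    rw [Finset.mem_powerset]
    exact Finset.sdiff_subset_sdiff (SimpleGraph.edgeFinset_mono le_top) subset_rfl
  have step3 : ∑ S ∈ C.powerset, W S ≤ (1 + θ * (x - 1)) ^ n := by
    rw [hW, ← Finset.prod_add]
    have hb : (1:ℝ) ≤ 1 + θ * (x - 1) := by nlinarith
    have : ∀ e ∈ C, θ * (if u ∈ e then x else 1) + (1 - θ) =
        if u ∈ e then 1 + θ * (x - 1) else 1 := by
      intro e _; split_ifs <;> ring
    rw [Finset.prod_congr rfl this, ← Finset.prod_filter, Finset.prod_const]
    refine pow_le_pow_right₀ hb ?_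
    have : (C.filter (fun e => u ∈ e)).card ≤ degOf (⊤ : SimpleGraph (Fin n)) u := by
      rw [ua_degOf_eq]
      refine Finset.card_le_card fun e he => ?_
      rw [Finset.mem_filter] at he ⊢
      refine ⟨?_, he.2⟩
      convert (Finset.mem_sdiff.1 he.1).1
    refine this.trans ?_
    have := Set.ncard_le_card ((⊤ : SimpleGraph (Fin n)).neighborSet u)
    simpa [degOf] using this
  calc _ ≤ _ := step1
    _ = x ^ degOf T u * ∑ g ∈ F, W (i g) := by rw [Finset.mul_sum]
    _ ≤ _ := by
      apply mul_le_mul_of_nonneg_left (step2.trans step3) (by positivity)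

lemma ua_apa {n : ℕ} (pa : Fin n → Fin n) :
    apaProb 1 0 pa = ∏ t : Fin n, if 2 ≤ t.val then ((t.val : ℝ))⁻¹ else 1 := by
  unfold apaProb
  refine Finset.prod_congr rfl fun t _ => ?_
  split_ifs <;> simp

lemma ua_apa_nonneg {n : ℕ} (pa : Fin n → Fin n) : 0 ≤ apaProb 1 0 pa := by
  rw [ua_apa]
  exact Finset.prod_nonneg fun t _ => by split_ifs <;> positivity

lemma ua_tree_mgf {n : ℕ} (x : ℝ) (u : Fin n) :
    ∑ pa ∈ Finset.univ.filter (fun pa : Fin n → Fin n => IsParentMap pa),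
      apaProb 1 0 pa * x ^ uaCh pa u
    = ∏ t : Fin n, if u.val < t.val then 1 + (x - 1) / t.val else 1 := by
  set A : Fin n → Finset (Fin n) := fun t =>
    if t.val = 0 then {t} else Finset.univ.filter (fun j => j.val < t.val) with hA
  have hS : Finset.univ.filter (fun pa : Fin n → Fin n => IsParentMap pa) = Fintype.piFinset A := by
    ext pa
    rw [Finset.mem_filter, Fintype.mem_piFinset]
    simp only [Finset.mem_univ, true_and, hA]
    constructor
    · intro h t
      by_cases ht : t.val = 0
      · simp [ht, h.1 t ht]
      · simp [ht]; exact h.2 t ht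
    · intro h
      constructor
      · intro t ht
        have := h t
        simpa [ht] using this
      · intro t ht
        have := h t
        simp only [ht, if_false, Finset.mem_filter, Finset.mem_univ, true_and] at this
        exact this
  rw [hS]
  have hterm : ∀ pa : Fin n → Fin n, apaProb 1 0 pa * x ^ uaCh pa u =
      ∏ t, ((if 2 ≤ t.val then ((t.val : ℝ))⁻¹ else 1) * (if t.val ≠ 0 ∧ pa t = u then x else 1)) := by
    intro pa
    rw [ua_apa, Finset.prod_mul_distrib, ← Finset.prod_filter (fun t : Fin n => t.val ≠ 0 ∧ pa t = u),
      Finset.prod_const, uaCh]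
  rw [Finset.sum_congr rfl fun pa _ => hterm pa]
  rw [← Finset.prod_univ_sum A (fun t j => ((if 2 ≤ t.val then ((t.val : ℝ))⁻¹ else 1) *
    (if t.val ≠ 0 ∧ j = u then x else 1)))]
  refine Finset.prod_congr rfl fun t _ => ?_
  by_cases ht : t.val = 0
  · simp [hA, ht]
  · have htpos : (0:ℝ) < t.val := by exact_mod_cast Nat.pos_of_ne_zero ht
    have h2 : (if 2 ≤ t.val then ((t.val : ℝ))⁻¹ else 1) = ((t.val : ℝ))⁻¹ := by
      split_ifs with h
      · rfl
      · have : t.val = 1 := by omega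
        simp [this]
    have hcard : (Finset.univ.filter (fun j : Fin n => j.val < t.val)).card = t.val := by
      have := Fin.card_Iio t
      rw [← this]; congr 1; ext j; simp
    simp only [hA, ht, if_false, h2, ne_eq, not_false_eq_true, true_and]
    rw [← Finset.mul_sum]
    have hsplit : ∀ j : Fin n, (if j = u then x else 1) = 1 + (if j = u then x - 1 else 0) := by
      intro j; split_ifs <;> ring
    rw [Finset.sum_congr rfl fun j _ => hsplit j, Finset.sum_add_distrib, Finset.sum_const, hcard,
      Finset.sum_ite_eq']
    simp only [Finset.mem_filter, Finset.mem_univ, true_and, nsmul_eq_mul, mul_one]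
    split_ifs
    · field_simp
    · field_simp; ring

lemma ua_paper_nonneg {n : ℕ} (θ : ℝ) (h0 : 0 ≤ θ) (h1 : θ ≤ 1) (g : SimpleGraph (Fin n)) :
    0 ≤ paperProb n 1 0 θ g := by
  have hθ' : 0 ≤ 1 - θ := by linarith
  unfold paperProb
  refine mul_nonneg (by positivity) (Finset.sum_nonneg fun pa _ => ?_)
  split_ifs
  · exact ua_apa_nonneg pa
  · exact le_rfl

lemma ua_swap {n : ℕ} (θ : ℝ) (f : SimpleGraph (Fin n) → ℝ) :
    ∑ g : SimpleGraph (Fin n), paperProb n 1 0 θ g * f g =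
    ∑ pa ∈ Finset.univ.filter (fun pa : Fin n → Fin n => IsParentMap pa), apaProb 1 0 pa *
      ∑ g ∈ Finset.univ.filter (fun g : SimpleGraph (Fin n) => treeGraph pa ≤ g),
      θ ^ (g.edgeSet.ncard - (n - 1)) * (1 - θ) ^ (n * (n - 1) / 2 - g.edgeSet.ncard) * f g := by
  rw [Finset.sum_filter]
  have : ∀ pa : Fin n → Fin n, (if IsParentMap pa then apaProb 1 0 pa *
      ∑ g ∈ Finset.univ.filter (fun g : SimpleGraph (Fin n) => treeGraph pa ≤ g),
      θ ^ (g.edgeSet.ncard - (n - 1)) * (1 - θ) ^ (n * (n - 1) / 2 - g.edgeSet.ncard) * f g else 0)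
      = ∑ g : SimpleGraph (Fin n), (θ ^ (g.edgeSet.ncard - (n - 1)) *
        (1 - θ) ^ (n * (n - 1) / 2 - g.edgeSet.ncard)) *
        (if IsParentMap pa ∧ treeGraph pa ≤ g then apaProb 1 0 pa else 0) * f g := by
    intro pa
    by_cases h : IsParentMap pa
    · rw [if_pos h, Finset.mul_sum, Finset.sum_filter]
      refine Finset.sum_congr rfl fun g _ => ?_
      by_cases h' : treeGraph pa ≤ g
      · rw [if_pos h', if_pos ⟨h, h'⟩]; ring
      · rw [if_neg h', if_neg (fun hh => h' hh.2)]; ring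
    · rw [if_neg h]
      symm
      refine Finset.sum_eq_zero fun g _ => ?_
      rw [if_neg (fun hh => h hh.1)]; ring
  rw [Finset.sum_congr rfl fun pa _ => this pa, Finset.sum_comm]
  refine Finset.sum_congr rfl fun g _ => ?_
  rw [paperProb, Finset.mul_sum, Finset.sum_mul]

lemma ua_upper {n : ℕ} (θ : ℝ) (h0 : 0 ≤ θ) (h1 : θ ≤ 1) (x : ℝ) (hx : 1 ≤ x) (u : Fin n) :
    ∑ g : SimpleGraph (Fin n), paperProb n 1 0 θ g * x ^ degOf g u ≤
      x * (1 + θ * (x - 1)) ^ n * ∏ t : Fin n, if u.val < t.val then 1 + (x - 1) / t.val else 1 := by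
  have hb : (0:ℝ) ≤ 1 + θ * (x - 1) := by nlinarith
  rw [ua_swap, ← ua_tree_mgf, Finset.mul_sum]
  refine Finset.sum_le_sum fun pa hpa => ?_
  have hpa' : IsParentMap pa := (Finset.mem_filter.1 hpa).2
  calc _ ≤ apaProb 1 0 pa * (x ^ degOf (treeGraph pa) u * (1 + θ * (x - 1)) ^ n) :=
        mul_le_mul_of_nonneg_left (ua_er pa hpa' θ h0 h1 x hx u) (ua_apa_nonneg pa)
    _ ≤ apaProb 1 0 pa * (x ^ (uaCh pa u + 1) * (1 + θ * (x - 1)) ^ n) := by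
        refine mul_le_mul_of_nonneg_left ?_ (ua_apa_nonneg pa)
        exact mul_le_mul_of_nonneg_right (pow_le_pow_right₀ hx (ua_deg_tree_le pa u)) (by positivity)
    _ = _ := by rw [pow_succ]; ring

lemma ua_lower {n : ℕ} (θ : ℝ) (h0 : 0 ≤ θ) (h1 : θ ≤ 1) (y : ℝ) (hy : 0 < y) (hy1 : y ≤ 1)
    (u : Fin n) :
    ∑ g : SimpleGraph (Fin n), paperProb n 1 0 θ g * y ^ degOf g u ≤
      ∏ t : Fin n, if u.val < t.val then 1 + (y - 1) / t.val else 1 := by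
  have hθ' : 0 ≤ 1 - θ := by linarith
  rw [ua_swap, ← ua_tree_mgf]
  refine Finset.sum_le_sum fun pa hpa => mul_le_mul_of_nonneg_left ?_ (ua_apa_nonneg pa)
  have hpa' : IsParentMap pa := (Finset.mem_filter.1 hpa).2
  have h := ua_er pa hpa' θ h0 h1 1 le_rfl u
  simp only [one_pow, mul_one, sub_self, mul_zero, add_zero] at h
  calc _ ≤ ∑ g ∈ Finset.univ.filter (fun g : SimpleGraph (Fin n) => treeGraph pa ≤ g),
      θ ^ (g.edgeSet.ncard - (n - 1)) * (1 - θ) ^ (n * (n - 1) / 2 - g.edgeSet.ncard) *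
        y ^ uaCh pa u := by
        refine Finset.sum_le_sum fun g hg => mul_le_mul_of_nonneg_left ?_ (by positivity)
        exact pow_le_pow_of_le_one hy.le hy1
          ((ua_le_deg_tree pa hpa' u).trans (ua_degOf_mono (Finset.mem_filter.1 hg).2 u))
    _ ≤ _ := by
        rw [← Finset.sum_mul]
        exact mul_le_of_le_one_left (by positivity) h

lemma ua_harm_upper (i n : ℕ) (hn : i + 1 ≤ n) :
    ∑ t ∈ Finset.range n, (if i < t then ((t:ℝ))⁻¹ else 0) ≤
      Real.log n - Real.log ((i:ℝ) + 1) + ((i:ℝ) + 1)⁻¹ - (n:ℝ)⁻¹ := by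
  induction n, hn using Nat.le_induction with
  | base =>
    rw [Finset.sum_eq_zero]
    · push_cast; simp
    · intro t ht
      rw [if_neg]; simp at ht; omega
  | succ n hn ih =>
    rw [Finset.sum_range_succ, if_pos (by omega)]
    have hnpos : (0:ℝ) < n := by exact_mod_cast (by omega : 0 < n)
    have h := Real.one_sub_inv_le_log_of_pos (x := ((n:ℝ)+1)/n) (by positivity)
    rw [Real.log_div (by positivity) (by positivity)] at h
    have e : 1 - (((n:ℝ)+1)/n)⁻¹ = ((n:ℝ)+1)⁻¹ := by field_simp; ring
    rw [e] at h
    push_cast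
    linarith

lemma ua_harm_lower (n : ℕ) (hn : 1 ≤ n) :
    Real.log n ≤ ∑ t ∈ Finset.range n, (if 0 < t then ((t:ℝ))⁻¹ else 0) := by
  induction n, hn using Nat.le_induction with
  | base => simp
  | succ n hn ih =>
    rw [Finset.sum_range_succ, if_pos (by omega)]
    have hnpos : (0:ℝ) < n := by exact_mod_cast (by omega : 0 < n)
    have h := Real.log_le_sub_one_of_pos (x := ((n:ℝ)+1)/n) (by positivity)
    rw [Real.log_div (by positivity) (by positivity)] at h
    have e : ((n:ℝ)+1)/n - 1 = (n:ℝ)⁻¹ := by field_simp; ring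
    rw [e] at h
    push_cast
    linarith

lemma ua_prod_le {n : ℕ} (x : ℝ) (hx : 0 < x) (u : Fin n) :
    (∏ t : Fin n, if u.val < t.val then 1 + (x - 1) / t.val else 1) ≤
      Real.exp ((x - 1) * ∑ t ∈ Finset.range n, (if u.val < t then ((t:ℝ))⁻¹ else 0)) := by
  rw [Finset.mul_sum, ← Fin.sum_univ_eq_sum_range
    (fun t => (x - 1) * (if u.val < t then ((t:ℝ))⁻¹ else 0)) n, Real.exp_sum]
  refine Finset.prod_le_prod ?_ ?_
  · intro t _
    split_ifs with h
    · have : (1:ℝ) ≤ t.val := by exact_mod_cast (by omega : 1 ≤ t.val)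
      have h2 : (x - 1) / t.val = x / t.val - 1 / t.val := by ring
      have h3 : 1 / (t.val:ℝ) ≤ 1 := by rw [div_le_one] <;> linarith
      have h4 : 0 ≤ x / (t.val : ℝ) := by positivity
      linarith
    · norm_num
  · intro t _
    split_ifs with h
    · have := Real.add_one_le_exp ((x - 1) * ((t.val:ℝ))⁻¹)
      rw [div_eq_mul_inv]; linarith
    · simp

lemma ua_main_fin {n : ℕ} (i0 : Fin n) (hi0 : i0.val = 0) (θ : ℝ) (h0 : 0 ≤ θ) (h1 : θ ≤ 1)
    (a m B x y : ℝ) (hm : 0 < m) (hB : 0 < B) (hx : 1 ≤ x) (hy : 0 < y) (hy1 : y ≤ 1) :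
    ∑ g : SimpleGraph (Fin n), (if (degOf g i0 : ℝ) ≤ a ∨
      m + B ≤ ((Finset.univ.filter (fun v : Fin n => a ≤ (degOf g v : ℝ))).card : ℝ) then
        paperProb n 1 0 θ g else 0) ≤
    y ^ (-a) * Real.exp (- (1 - y) * Real.log n) +
      B⁻¹ * (n * (x ^ (-a) * (x * Real.exp (n * θ * (x - 1)) *
        Real.exp ((x - 1) * (1 + Real.log n - Real.log m))))) := by
  have hn : 1 ≤ n := by have := i0.2; omega
  have hx0 : 0 < x := by linarith
  have hp := ua_paper_nonneg (n := n) θ h0 h1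
  set V := Finset.univ.filter (fun v : Fin n => m < (v.val : ℝ) + 1) with hV
  have hpt : ∀ g : SimpleGraph (Fin n), (if (degOf g i0 : ℝ) ≤ a ∨
      m + B ≤ ((Finset.univ.filter (fun v : Fin n => a ≤ (degOf g v : ℝ))).card : ℝ) then
        paperProb n 1 0 θ g else 0) ≤ y ^ (-a) * (paperProb n 1 0 θ g * y ^ degOf g i0) +
        B⁻¹ * ∑ v ∈ V, x ^ (-a) * (paperProb n 1 0 θ g * x ^ degOf g v) := by
    intro g
    have hA : 0 ≤ y ^ (-a) * (paperProb n 1 0 θ g * y ^ degOf g i0) := by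
      have := hp g; positivity
    have hBn : 0 ≤ B⁻¹ * ∑ v ∈ V, x ^ (-a) * (paperProb n 1 0 θ g * x ^ degOf g v) := by
      have := hp g
      exact mul_nonneg (by positivity) (Finset.sum_nonneg fun v _ => by positivity)
    split_ifs with h
    · rcases h with h | h
      · have : 1 ≤ y ^ (-a) * y ^ degOf g i0 := by
          rw [← Real.rpow_natCast, ← Real.rpow_add hy]
          exact Real.one_le_rpow_of_pos_of_le_one_of_nonpos hy hy1 (by linarith)
        have := mul_le_mul_of_nonneg_left this (hp g)
        linarith
      · have hsub : (Finset.univ.filter (fun v : Fin n => a ≤ (degOf g v : ℝ))) ⊆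
            (Finset.univ.filter (fun v : Fin n => (v.val:ℝ) + 1 ≤ m)) ∪
            V.filter (fun v : Fin n => a ≤ (degOf g v : ℝ)) := by
          intro v hv
          simp only [hV, Finset.mem_union, Finset.mem_filter, Finset.mem_univ, true_and] at hv ⊢
          rcases le_or_gt ((v.val:ℝ) + 1) m with h | h
          · exact Or.inl h
          · exact Or.inr ⟨h, hv⟩
        have hc := (Finset.card_le_card hsub).trans (Finset.card_union_le _ _)
        have hc1 : ((Finset.univ.filter (fun v : Fin n => (v.val:ℝ) + 1 ≤ m)).card : ℝ) ≤ m := by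
          have : (Finset.univ.filter (fun v : Fin n => (v.val:ℝ) + 1 ≤ m)).card ≤ ⌊m⌋₊ := by
            rw [← Finset.card_range ⌊m⌋₊]
            refine Finset.card_le_card_of_injOn (fun v => v.val) ?_ (fun v _ w _ h => Fin.ext h)
            intro v hv
            simp only [Finset.coe_filter, Finset.mem_univ, true_and, Set.mem_ofPred_eq] at hv
            simp only [Finset.coe_range, Set.mem_Iio]
            exact Nat.lt_of_succ_le (Nat.le_floor (by push_cast; exact hv))
          exact (Nat.cast_le.2 this).trans (Nat.floor_le hm.le)
        have hc' : ((Finset.univ.filter (fun v : Fin n => a ≤ (degOf g v : ℝ))).card : ℝ) ≤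
            ((Finset.univ.filter (fun v : Fin n => (v.val:ℝ) + 1 ≤ m)).card : ℝ) +
            ((V.filter (fun v : Fin n => a ≤ (degOf g v : ℝ))).card : ℝ) := by exact_mod_cast hc
        have hBle : B ≤ ((V.filter (fun v : Fin n => a ≤ (degOf g v : ℝ))).card : ℝ) := by linarith
        have hBs : B * paperProb n 1 0 θ g ≤
            ∑ v ∈ V, x ^ (-a) * (paperProb n 1 0 θ g * x ^ degOf g v) := by
          calc _ ≤ ((V.filter (fun v : Fin n => a ≤ (degOf g v : ℝ))).card : ℝ) *
                paperProb n 1 0 θ g := mul_le_mul_of_nonneg_right hBle (hp g)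
            _ = ∑ v ∈ V.filter (fun v : Fin n => a ≤ (degOf g v : ℝ)), paperProb n 1 0 θ g := by
                rw [Finset.sum_const, nsmul_eq_mul]
            _ ≤ ∑ v ∈ V.filter (fun v : Fin n => a ≤ (degOf g v : ℝ)),
                x ^ (-a) * (paperProb n 1 0 θ g * x ^ degOf g v) := by
                refine Finset.sum_le_sum fun v hv => ?_
                have hv' := (Finset.mem_filter.1 hv).2
                have : 1 ≤ x ^ (-a) * x ^ degOf g v := by
                  rw [← Real.rpow_natCast, ← Real.rpow_add hx0]
                  exact Real.one_le_rpow hx (by linarith)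
                have := mul_le_mul_of_nonneg_left this (hp g)
                linarith
            _ ≤ _ := by
                refine Finset.sum_le_sum_of_subset_of_nonneg (Finset.filter_subset _ _) ?_
                intro v _ _
                have := hp g
                positivity
        have : paperProb n 1 0 θ g ≤
            B⁻¹ * ∑ v ∈ V, x ^ (-a) * (paperProb n 1 0 θ g * x ^ degOf g v) := by
          rw [le_inv_mul_iff₀ hB]; exact hBs
        linarith
    · linarith
  refine (Finset.sum_le_sum fun g _ => hpt g).trans ?_
  rw [Finset.sum_add_distrib, ← Finset.mul_sum, ← Finset.mul_sum, Finset.sum_comm]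
  refine add_le_add ?_ ?_
  · refine mul_le_mul_of_nonneg_left ?_ (by positivity)
    refine (ua_lower θ h0 h1 y hy hy1 i0).trans ((ua_prod_le y hy i0).trans ?_)
    rw [Real.exp_le_exp, hi0]
    have := ua_harm_lower n hn
    nlinarith
  · refine mul_le_mul_of_nonneg_left ?_ (by positivity)
    have hK : ∀ v ∈ V, ∑ g : SimpleGraph (Fin n), x ^ (-a) * (paperProb n 1 0 θ g * x ^ degOf g v) ≤
        (x ^ (-a) * (x * Real.exp (n * θ * (x - 1)) *
        Real.exp ((x - 1) * (1 + Real.log n - Real.log m)))) := by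
      intro v hv
      rw [← Finset.mul_sum]
      refine mul_le_mul_of_nonneg_left ?_ (by positivity)
      refine (ua_upper θ h0 h1 x hx v).trans ?_
      have hb : (0:ℝ) ≤ 1 + θ * (x - 1) := by nlinarith
      have e1 : (1 + θ * (x - 1)) ^ n ≤ Real.exp (n * θ * (x - 1)) := by
        have := Real.add_one_le_exp (θ * (x - 1))
        have h2 := pow_le_pow_left₀ hb (by linarith : 1 + θ * (x - 1) ≤ Real.exp (θ * (x - 1))) n
        rw [← Real.exp_nat_mul] at h2
        rwa [← mul_assoc] at h2
      have e2 := ua_prod_le x hx0 v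
      have e3 : Real.exp ((x - 1) * ∑ t ∈ Finset.range n, (if v.val < t then ((t:ℝ))⁻¹ else 0)) ≤
          Real.exp ((x - 1) * (1 + Real.log n - Real.log m)) := by
        rw [Real.exp_le_exp]
        refine mul_le_mul_of_nonneg_left ?_ (by linarith)
        have h1 := ua_harm_upper v.val n v.2
        have h2 : Real.log m ≤ Real.log ((v.val : ℝ) + 1) :=
          Real.log_le_log hm (Finset.mem_filter.1 hv).2.le
        have h3 : ((v.val : ℝ) + 1)⁻¹ ≤ 1 := inv_le_one_of_one_le₀ (by
          have : (0:ℝ) ≤ v.val := by positivity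
          linarith)
        have h4 : (0:ℝ) ≤ (n:ℝ)⁻¹ := by positivity
        linarith
      calc _ ≤ x * (1 + θ * (x - 1)) ^ n * Real.exp ((x - 1) * (1 + Real.log n - Real.log m)) :=
            mul_le_mul_of_nonneg_left (e2.trans e3) (by positivity)
        _ ≤ _ := by gcongr
    refine (Finset.sum_le_sum hK).trans ?_
    rw [Finset.sum_const, nsmul_eq_mul]
    refine mul_le_mul_of_nonneg_right ?_ (by positivity)
    have : V.card ≤ n := by simpa using Finset.card_le_univ V
    exact_mod_cast this

lemma ua_exponent (η : ℝ) (h0 : 0 < η) (h1 : η < 1) :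
    (2 - η) * hBennett (η / (2 - η)) = 2 * Real.log (2 / (2 - η)) - η := by
  have h2 : 2 - η ≠ 0 := by linarith
  have : 1 + η / (2 - η) = 2 / (2 - η) := by field_simp; ring
  rw [hBennett, this]
  field_simp

lemma ua_kappa (η : ℝ) (h0 : 0 < η) (h1 : η < 1) :
    (2 - η) * hBennett (η / (2 - η)) + η + Real.log (1 - η) < 0 := by
  rw [ua_exponent η h0 h1]
  have h2 : 0 < 2 - η := by linarith
  have h3 : 0 < 1 - η := by linarith
  have e : 2 * Real.log (2 / (2 - η)) - η + η + Real.log (1 - η) =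
      Real.log ((2 / (2 - η)) ^ 2 * (1 - η)) := by
    rw [Real.log_mul (by positivity) h3.ne', Real.log_pow]; push_cast; ring
  rw [e]
  apply Real.log_neg (by positivity)
  rw [div_pow, div_mul_eq_mul_div, div_lt_one (by positivity)]
  nlinarith [sq_pos_of_pos h0]

lemma ua_asymp (θ : ℕ → ℝ) (hθ0 : ∀ n, 0 ≤ θ n) (hθ1 : ∀ n, θ n ≤ 1)
    (hθ : Filter.Tendsto (fun n : ℕ => θ n * (n : ℝ) / Real.log (n : ℝ))
      Filter.atTop (nhds 0)) (ε : ℝ) (hε : 0 < ε) (η : ℝ) (hη0 : 0 < η) (hη1 : η < 1)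
    (r : ℝ) (hr : 0 < r) :
    ∀ᶠ n : ℕ in Filter.atTop, ∀ i0 : Fin n, i0.val = 0 →
      ∑ g : SimpleGraph (Fin n), (if degOf g i0 = 0 ∨ ⌈Lbound η n ε⌉₊ ≤
        (Finset.univ.filter (fun v : Fin n => degOf g i0 ≤ degOf g v)).card then
        paperProb n 1 0 (θ n) g else 0) ≤ r := by
  set c := (2 - η) * hBennett (η / (2 - η)) with hc
  set κ := -(c + η + Real.log (1 - η)) with hκ
  have hκ0 : 0 < κ := by have := ua_kappa η hη0 hη1; rw [hκ]; linarith
  have h1η : 0 < 1 - η := by linarith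
  set x := (1 - η)⁻¹ with hx
  have hx1 : 1 < x := by rw [hx]; exact (one_lt_inv₀ h1η).2 (by linarith)
  have hlx : Real.log x = - Real.log (1 - η) := by rw [hx, Real.log_inv]
  have hlx0 : 0 < Real.log x := Real.log_pos hx1
  have hxη : (x - 1) * (1 - η) = η := by rw [hx]; field_simp; ring
  set δ := min (1/2) (κ / (2 * (Real.log x + (x - 1)))) with hδ
  have hδ0 : 0 < δ := by
    rw [hδ]; apply lt_min (by norm_num); apply div_pos hκ0; nlinarith
  have hδ1 : δ ≤ 1/2 := min_le_left _ _
  have hδ2 : δ * (Real.log x + (x - 1)) ≤ κ / 2 := by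
    have : δ ≤ κ / (2 * (Real.log x + (x - 1))) := min_le_right _ _
    rw [le_div_iff₀ (by nlinarith)] at this
    linarith
  set y := (1 + δ)⁻¹ with hy
  have hy0 : 0 < y := by positivity
  have hy1 : y ≤ 1 := inv_le_one_of_one_le₀ (by linarith)
  set q := δ * δ * δ / (1 + δ) with hq
  have hq0 : 0 < q := by positivity
  have hlim : Filter.Tendsto (fun n : ℕ => Real.exp (-(q * Real.log n)) +
      ε * x * Real.exp (x - 1) * Real.exp (-(κ / 2 * Real.log n))) Filter.atTop (nhds 0) := by
    have hlog : Filter.Tendsto (fun n : ℕ => Real.log (n:ℝ)) Filter.atTop Filter.atTop :=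
      Real.tendsto_log_atTop.comp tendsto_natCast_atTop_atTop
    have t1 := Real.tendsto_exp_neg_atTop_nhds_zero.comp (hlog.const_mul_atTop hq0)
    have t2 := Real.tendsto_exp_neg_atTop_nhds_zero.comp
      (hlog.const_mul_atTop (half_pos hκ0))
    have := t1.add (t2.const_mul (ε * x * Real.exp (x - 1)))
    simpa using this
  filter_upwards [hlim.eventually (gt_mem_nhds hr), hθ.eventually (gt_mem_nhds hδ0),
    Filter.eventually_ge_atTop 3] with n hn hθn hn3 i0 hi0
  have hn0 : (0:ℝ) < n := by exact_mod_cast (by omega : 0 < n)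
  set l := Real.log (n:ℝ) with hl
  have hl0 : 0 < l := Real.log_pos (by exact_mod_cast (by omega : 1 < n))
  have hθl : n * θ n ≤ δ * l := by
    rw [div_lt_iff₀ hl0] at hθn; linarith
  set a := (1 - δ) * l with ha
  have ha0 : 0 ≤ a := mul_nonneg (by linarith) hl0.le
  have hm : (0:ℝ) < (n:ℝ) ^ η := by positivity
  have hB : (0:ℝ) < ε⁻¹ * (n : ℝ) ^ (1 - c) := by positivity
  have hfin := ua_main_fin i0 hi0 (θ n) (hθ0 n) (hθ1 n) a ((n:ℝ) ^ η) (ε⁻¹ * (n : ℝ) ^ (1 - c))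
    x y hm hB hx1.le hy0 hy1
  refine le_trans ?_ (hfin.trans (le_trans ?_ hn.le))
  · refine Finset.sum_le_sum fun g _ => ?_
    have hp := ua_paper_nonneg (θ n) (hθ0 n) (hθ1 n) g
    by_cases hd : (degOf g i0 : ℝ) ≤ a
    · rw [if_pos (Or.inl hd)]
      split_ifs
      · exact le_rfl
      · exact hp
    · push Not at hd
      split_ifs with h1 h2 h2
      · exact le_rfl
      · exfalso
        apply h2
        right
        rcases h1 with h1 | h1
        · rw [h1] at hd; simp at hd; linarith
        · have h3 := (Nat.le_ceil (Lbound η n ε)).trans (Nat.cast_le.2 h1)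
          rw [Lbound] at h3
          refine h3.trans (Nat.cast_le.2 (Finset.card_le_card ?_))
          intro v hv
          rw [Finset.mem_filter] at hv ⊢
          refine ⟨hv.1, hd.le.trans (by exact_mod_cast hv.2)⟩
      · exact hp
      · exact le_rfl
  · refine add_le_add ?_ ?_
    · rw [Real.rpow_def_of_pos hy0, ← Real.exp_add, Real.exp_le_exp]
      have e1 : Real.log y = - Real.log (1 + δ) := by rw [hy, Real.log_inv]
      have e2 : Real.log (1 + δ) ≤ δ := by
        have := Real.log_le_sub_one_of_pos (x := 1 + δ) (by linarith); linarith
      have e3 : 1 - y = δ / (1 + δ) := by rw [hy]; field_simp; ring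
      have e4 : q = δ / (1 + δ) - δ * (1 - δ) := by rw [hq]; field_simp; ring
      rw [e1, e3, e4]
      have := mul_le_mul_of_nonneg_right e2 ha0
      rw [ha] at this ⊢
      linarith
    · have hnE : (n:ℝ) = Real.exp l := by rw [hl, Real.exp_log hn0]
      have hlm : Real.log ((n:ℝ) ^ η) = η * l := Real.log_rpow hn0 η
      have e1 : (ε⁻¹ * (n : ℝ) ^ (1 - c))⁻¹ = ε * Real.exp (-(l * (1 - c))) := by
        rw [mul_inv, inv_inv, Real.rpow_def_of_pos hn0, ← Real.exp_neg]
      rw [hlm, e1, Real.rpow_def_of_pos (by linarith : 0 < x)]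
      have e2 : ε * Real.exp (-(l * (1 - c))) * (n * (Real.exp (Real.log x * -a) *
          (x * Real.exp (n * θ n * (x - 1)) * Real.exp ((x - 1) * (1 + l - η * l))))) =
          ε * x * Real.exp (x - 1) * Real.exp (-(l * (1 - c)) + l + Real.log x * -a +
            n * θ n * (x - 1) + (x - 1) * (l - η * l)) := by
        have : (x - 1) * (1 + l - η * l) = (x - 1) + (x - 1) * (l - η * l) := by ring
        rw [this]
        simp only [Real.exp_add]
        rw [← hnE]; ring
      rw [e2]
      refine mul_le_mul_of_nonneg_left ?_ (by positivity)
      rw [Real.exp_le_exp]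
      have e3 : n * θ n * (x - 1) ≤ δ * l * (x - 1) :=
        mul_le_mul_of_nonneg_right hθl (by linarith)
      have e4 : (x - 1) * (l - η * l) = η * l := by
        have : (x - 1) * (1 - η) * l = η * l := by rw [hxη]
        linarith
      have e5 := mul_le_mul_of_nonneg_right hδ2 hl0.le
      have e6 : c = -κ - η + Real.log x := by rw [hlx, hκ]; ring
      rw [e4, ha, e6]
      nlinarith

lemma ua_kthMax {n : ℕ} (d : Fin n → ℕ) (k m : ℕ) (h : m ≤ kthMax d k) :
    m = 0 ∨ k ≤ (Finset.univ.filter (fun v : Fin n => m ≤ d v)).card := by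
  rcases Nat.eq_zero_or_pos m with hm | hm
  · exact Or.inl hm
  right
  unfold kthMax at h
  set S := {x : ℕ | k ≤ (Finset.univ.filter (fun v : Fin n => x ≤ d v)).card} with hS
  have hne : S.Nonempty := by
    by_contra hne
    rw [Set.not_nonempty_iff_eq_empty] at hne
    rw [hne] at h; simp at h; omega
  have hbdd : BddAbove S := by
    by_contra hb
    rw [Nat.sSup_of_not_bddAbove hb] at h; omega
  have hmem : k ≤ (Finset.univ.filter (fun v : Fin n => sSup S ≤ d v)).card := Nat.sSup_mem hne hbdd
  refine hmem.trans (Finset.card_le_card fun v hv => ?_)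
  rw [Finset.mem_filter] at hv ⊢
  exact ⟨hv.1, h.trans hv.2⟩

lemma ua_degOf_comap {n : ℕ} (g : SimpleGraph (Fin n)) (σ : Fin n ≃ Fin n) (v : Fin n) :
    degOf (g.comap ⇑σ) v = degOf g (σ v) := by
  unfold degOf
  have : g.neighborSet (σ v) = σ '' (g.comap ⇑σ).neighborSet v := by
    ext w
    simp only [SimpleGraph.mem_neighborSet, Set.mem_image, SimpleGraph.comap_adj]
    constructor
    · intro h; exact ⟨σ.symm w, by simpa using h, by simp⟩
    · rintro ⟨w', h, rfl⟩; exact h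
  rw [this, Set.ncard_image_of_injective _ σ.injective]

/-- rank of a node (pessimistic with ties) in the degree order -/
def uaRank {n : ℕ} (g : SimpleGraph (Fin n)) (v : Fin n) : ℕ :=
  (Finset.univ.filter (fun w : Fin n => degOf g v ≤ degOf g w)).card

lemma ua_rank_comap {n : ℕ} (g : SimpleGraph (Fin n)) (σ : Fin n ≃ Fin n) (v : Fin n) :
    uaRank (g.comap ⇑σ) v = uaRank g (σ v) := by
  unfold uaRank
  refine Finset.card_equiv σ fun w => ?_
  simp [ua_degOf_comap]

/-- the set of nodes with rank less than `k` -/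
def uaC {n : ℕ} (k : ℕ) (g : SimpleGraph (Fin n)) : Finset (Fin n) :=
  Finset.univ.filter (fun v => uaRank g v < k)

lemma ua_mem_C {n : ℕ} (k : ℕ) (g : SimpleGraph (Fin n)) (v : Fin n) :
    v ∈ uaC k g ↔ uaRank g v < k := by simp [uaC]

lemma ua_C_card {n : ℕ} (k : ℕ) (hk : 0 < k) (g : SimpleGraph (Fin n)) : (uaC k g).card < k := by
  rcases (uaC k g).eq_empty_or_nonempty with h | h
  · rw [h]; simpa using hk
  · obtain ⟨v, hv, hmin⟩ := Finset.exists_min_image (uaC k g) (degOf g) h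
    refine lt_of_le_of_lt (Finset.card_le_card ?_) ((ua_mem_C k g v).1 hv)
    intro w hw
    exact Finset.mem_filter.2 ⟨Finset.mem_univ _, hmin w hw⟩

lemma ua_comap_sum {n : ℕ} (σ : Fin n ≃ Fin n) (H : SimpleGraph (Fin n) → ℝ) :
    ∑ g : SimpleGraph (Fin n), H (g.comap ⇑σ) = ∑ g : SimpleGraph (Fin n), H g := by
  refine Fintype.sum_bijective (fun g : SimpleGraph (Fin n) => g.comap ⇑σ) ?_ _ _ (fun _ => rfl)
  rw [Function.bijective_iff_has_inverse]
  refine ⟨fun g => g.comap ⇑σ.symm, fun g => ?_, fun g => ?_⟩ <;> ext a b <;> simp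

lemma ua_perm_sum {n : ℕ} (σ : Fin n ≃ Fin n) (H : (Fin n ≃ Fin n) → ℝ) :
    ∑ π : Fin n ≃ Fin n, H (π.trans σ) = ∑ π : Fin n ≃ Fin n, H π := by
  refine Fintype.sum_bijective (fun π : Fin n ≃ Fin n => π.trans σ) ?_ _ _ (fun _ => rfl)
  rw [Function.bijective_iff_has_inverse]
  refine ⟨fun π => π.trans σ.symm, fun π => ?_, fun π => ?_⟩ <;> ext a <;> simp

lemma ua_comap_trans {n : ℕ} (g : SimpleGraph (Fin n)) (σ π : Fin n ≃ Fin n) :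
    (g.comap ⇑σ).comap ⇑π = g.comap ⇑(π.trans σ) := by
  ext a b; simp

lemma ua_post_comap {n : ℕ} [NeZero n] (θ : ℝ) (g : SimpleGraph (Fin n)) (σ : Fin n ≃ Fin n)
    (u : Fin n) : postRoot n 1 0 θ (g.comap ⇑σ) u = postRoot n 1 0 θ g (σ u) := by
  unfold postRoot
  simp only [ua_comap_trans]
  congr 1
  · rw [← ua_perm_sum σ (fun π => if π 0 = σ u then paperProb n 1 0 θ (g.comap ⇑π) else 0)]
    refine Finset.sum_congr rfl fun π _ => ?_
    simp
  · exact ua_perm_sum σ (fun π => paperProb n 1 0 θ (g.comap ⇑π))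

lemma ua_top {n : ℕ} (f : Fin n → ℝ) (S : Finset (Fin n)) :
    ∃ s : Finset (Fin n), s.card = S.card ∧ ∑ u ∈ S, f u ≤ ∑ u ∈ s, f u ∧
      ∀ u ∈ s, ∀ v ∈ Finset.univ \ s, f v ≤ f u := by
  obtain ⟨s, hs, hmax⟩ := Finset.exists_max_image (Finset.powersetCard S.card Finset.univ)
    (fun s => ∑ u ∈ s, f u) ⟨S, by simp⟩
  have hsc : s.card = S.card := (Finset.mem_powersetCard.1 hs).2
  refine ⟨s, hsc, hmax S (by simp), ?_⟩
  intro u hu v hv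
  have hv' : v ∉ s := (Finset.mem_sdiff.1 hv).2
  have hve : v ∉ s.erase u := fun h => hv' (Finset.mem_of_mem_erase h)
  have h := hmax (insert v (s.erase u)) (by
    rw [Finset.mem_powersetCard]
    refine ⟨Finset.subset_univ _, ?_⟩
    rw [Finset.card_insert_of_notMem hve, Finset.card_erase_of_mem hu, ← hsc]
    have := Finset.card_pos.2 ⟨u, hu⟩
    omega)
  rw [Finset.sum_insert hve, ← Finset.add_sum_erase s f hu] at h
  linarith

lemma ua_cred_le {n : ℕ} [NeZero n] (θ ε : ℝ) (g : SimpleGraph (Fin n)) (S : Finset (Fin n))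
    (h : 1 - ε ≤ ∑ u ∈ S, postRoot n 1 0 θ g u) : credSize n 1 0 θ ε g ≤ S.card := by
  obtain ⟨s, h1, h2, h3⟩ := ua_top (postRoot n 1 0 θ g) S
  exact Nat.sInf_le ⟨s, h1, h.trans h2, h3⟩

lemma ua_psi_comap {n : ℕ} [NeZero n] (θ : ℝ) (k : ℕ) (g : SimpleGraph (Fin n))
    (σ : Fin n ≃ Fin n) :
    ∑ u ∈ uaC k (g.comap ⇑σ), postRoot n 1 0 θ (g.comap ⇑σ) u =
      ∑ u ∈ uaC k g, postRoot n 1 0 θ g u := by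
  refine Finset.sum_equiv σ (fun u => ?_) (fun u _ => ua_post_comap θ g σ u)
  rw [ua_mem_C, ua_mem_C, ua_rank_comap]

lemma ua_bayes {n : ℕ} [NeZero n] (θ : ℝ) (h0 : 0 ≤ θ) (h1 : θ ≤ 1) (ε : ℝ) (k : ℕ) :
    ε * ∑ g : SimpleGraph (Fin n), (if ∑ u ∈ uaC k g, postRoot n 1 0 θ g u < 1 - ε then
      paperProb n 1 0 θ g else 0) ≤
    ∑ g : SimpleGraph (Fin n), (if (0 : Fin n) ∈ uaC k g then 0 else paperProb n 1 0 θ g) := by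
  set H1 : SimpleGraph (Fin n) → ℝ := fun g => if ∑ u ∈ uaC k g, postRoot n 1 0 θ g u < 1 - ε then
      paperProb n 1 0 θ g else 0 with hH1
  set H2 : SimpleGraph (Fin n) → ℝ := fun g =>
    if (0 : Fin n) ∈ uaC k g then 0 else paperProb n 1 0 θ g with hH2
  have hsym : ∀ H : SimpleGraph (Fin n) → ℝ, ∑ g : SimpleGraph (Fin n),
      ∑ π : Fin n ≃ Fin n, H (g.comap ⇑π) =
      (Fintype.card (Fin n ≃ Fin n) : ℝ) * ∑ g : SimpleGraph (Fin n), H g := by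
    intro H
    rw [Finset.sum_comm, Finset.sum_congr rfl fun π _ => ua_comap_sum π H, Finset.sum_const,
      nsmul_eq_mul, Finset.card_univ]
  have hN : (0:ℝ) < (Fintype.card (Fin n ≃ Fin n) : ℝ) := by
    exact_mod_cast Fintype.card_pos
  have key : ∀ g : SimpleGraph (Fin n), ε * ∑ π : Fin n ≃ Fin n, H1 (g.comap ⇑π) ≤
      ∑ π : Fin n ≃ Fin n, H2 (g.comap ⇑π) := by
    intro g
    have hp : ∀ π : Fin n ≃ Fin n, 0 ≤ paperProb n 1 0 θ (g.comap ⇑π) := fun π =>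
      ua_paper_nonneg θ h0 h1 _
    have hH2' : ∀ π : Fin n ≃ Fin n, H2 (g.comap ⇑π) =
        if π 0 ∈ uaC k g then 0 else paperProb n 1 0 θ (g.comap ⇑π) := by
      intro π
      simp only [hH2, ua_mem_C, ua_rank_comap]
    have hRn : 0 ≤ ∑ π : Fin n ≃ Fin n, H2 (g.comap ⇑π) := by
      refine Finset.sum_nonneg fun π _ => ?_
      rw [hH2']; split_ifs
      · exact le_rfl
      · exact hp π
    simp only [hH1, ua_psi_comap]
    by_cases hlt : ∑ u ∈ uaC k g, postRoot n 1 0 θ g u < 1 - ε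
    · simp only [if_pos hlt]
      set Z := ∑ π : Fin n ≃ Fin n, paperProb n 1 0 θ (g.comap ⇑π) with hZ
      have hZ0 : 0 ≤ Z := Finset.sum_nonneg fun π _ => hp π
      rcases hZ0.eq_or_lt with hz | hz
      · rw [← hz, mul_zero]; exact hRn
      · have e1 : (∑ u ∈ uaC k g, postRoot n 1 0 θ g u) * Z =
            ∑ π : Fin n ≃ Fin n, if π 0 ∈ uaC k g then paperProb n 1 0 θ (g.comap ⇑π) else 0 := by
          unfold postRoot
          rw [← Finset.sum_div, ← hZ, div_mul_cancel₀ _ hz.ne', Finset.sum_comm]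
          refine Finset.sum_congr rfl fun π _ => ?_
          rw [Finset.sum_ite_eq]
        have e2 : Z = (∑ π : Fin n ≃ Fin n,
            if π 0 ∈ uaC k g then paperProb n 1 0 θ (g.comap ⇑π) else 0) +
            ∑ π : Fin n ≃ Fin n, H2 (g.comap ⇑π) := by
          rw [hZ, ← Finset.sum_add_distrib]
          refine Finset.sum_congr rfl fun π _ => ?_
          rw [hH2']; split_ifs <;> simp
        have := mul_lt_mul_of_pos_right hlt hz
        linarith
    · simp only [if_neg hlt]
      simpa using hRn
  have := Finset.sum_le_sum fun g (_ : g ∈ Finset.univ) => key g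
  rw [← Finset.mul_sum, hsym, hsym] at this
  have h2 : (Fintype.card (Fin n ≃ Fin n) : ℝ) * (ε * ∑ g, H1 g) ≤
      (Fintype.card (Fin n ≃ Fin n) : ℝ) * ∑ g, H2 g := by linarith
  exact le_of_mul_le_mul_left h2 hN

lemma ua_Lbound_pos (η ε : ℝ) (n : ℕ) (hn : 0 < n) (hε : 0 < ε) : 0 < Lbound η n ε := by
  have : (0:ℝ) < n := by exact_mod_cast hn
  unfold Lbound; positivity

lemma ua_Lbound_le (n : ℕ) (hn : 0 < n) : Lbound (4/5) n (1/2) ≤ 3 * (n:ℝ) ^ (4/5 : ℝ) := by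
  have h1 : (1:ℝ) ≤ n := by exact_mod_cast hn
  have hlog : (1:ℝ)/2 ≤ Real.log (5/3) := by
    have h2 : (1:ℝ) ≤ Real.log ((5/3)^2) := by
      rw [Real.le_log_iff_exp_le (by norm_num)]
      have := Real.exp_one_lt_d9
      norm_num at this ⊢; linarith
    rw [Real.log_pow] at h2; push_cast at h2; linarith
  have hle : (n:ℝ) ^ (1 - (2 - (4/5:ℝ)) * hBennett ((4/5) / (2 - 4/5))) ≤ (n:ℝ) ^ (4/5:ℝ) := by
    apply Real.rpow_le_rpow_of_exponent_le h1
    rw [ua_exponent (4/5) (by norm_num) (by norm_num)]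
    have : (2:ℝ) / (2 - 4/5) = 5/3 := by norm_num
    rw [this]; linarith
  unfold Lbound
  norm_num at hle ⊢
  linarith

lemma ua_limsup_le (f : ℕ → ℝ) (hf : ∀ n, 0 ≤ f n) (r : ℝ) (h : ∀ᶠ n in Filter.atTop, f n ≤ r) :
    Filter.limsup f Filter.atTop ≤ r :=
  Filter.limsup_le_of_le
    (Filter.IsCoboundedUnder.of_frequently_ge (a := 0) (Filter.Frequently.of_forall hf)) h

/-- **Theorem `ua-conf-size` (uniform attachment).**  Let `G_n ~ PAPER(α,β,θ)`
with `α = 1`, `β = 0`, and suppose `θ = θ_n = o(log n / n)`.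
(i) For every `ε ∈ (0,1)` and `η ∈ (0,1)`,
`limsup_n P(D_{G_n}(1) ≤ L_{η,n,ε}-max(D_{G_n})) ≤ ε`.
(ii) Consequently there is `γ ≤ 0.8` such that for every `ε ∈ (0,1)` the
quantity `n^{-γ} ε⁻¹ |B_ε(G*_n)|` is stochastically bounded (`O_p(1)`): for
every `η' > 0` there is `M` with
`limsup_n P(n^{-γ} ε⁻¹ |B_ε(G*_n)| > M) ≤ η'`. -/
theorem ua_root_confidence_set_size
    (θ : ℕ → ℝ) (hθ0 : ∀ n, 0 ≤ θ n) (hθ1 : ∀ n, θ n ≤ 1)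
    (hθ : Filter.Tendsto (fun n : ℕ => θ n * (n : ℝ) / Real.log (n : ℝ))
      Filter.atTop (nhds 0))
    (ρ : ∀ n : ℕ, Fin n ≃ Fin n) :
    -- part (i)
    (∀ ε : ℝ, 0 < ε → ε < 1 → ∀ η : ℝ, 0 < η → η < 1 →
      Filter.limsup (fun n : ℕ =>
          if h : n = 0 then 0 else
            ∑ g : SimpleGraph (Fin n),
              if degOf g ⟨0, Nat.pos_of_ne_zero h⟩ ≤ kthMax (degOf g) ⌈Lbound η n ε⌉₊ then
                paperProb n 1 0 (θ n) g
              else 0)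
        Filter.atTop ≤ ε) ∧
    -- part (ii)
    (∃ γ : ℝ, γ ≤ 0.8 ∧ ∀ ε : ℝ, 0 < ε → ε < 1 → ∀ η' : ℝ, 0 < η' → ∃ M : ℝ,
      Filter.limsup (fun n : ℕ =>
          if h : n = 0 then 0 else
            letI : NeZero n := ⟨h⟩
            ∑ g : SimpleGraph (Fin n),
              if M < (n : ℝ) ^ (-γ) * ε⁻¹ * (credSize n 1 0 (θ n) ε (g.comap ⇑(ρ n).symm) : ℝ) then
                paperProb n 1 0 (θ n) g
              else 0)
        Filter.atTop ≤ η') := by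
  constructor
  · intro ε hε hε1 η hη0 hη1
    apply ua_limsup_le
    · intro n
      split_ifs with h
      · exact le_rfl
      · refine Finset.sum_nonneg fun g _ => ?_
        split_ifs
        · exact ua_paper_nonneg _ (hθ0 n) (hθ1 n) g
        · exact le_rfl
    · filter_upwards [ua_asymp θ hθ0 hθ1 hθ ε hε η hη0 hη1 ε hε, Filter.eventually_gt_atTop 0]
        with n hn hn0
      rw [dif_neg hn0.ne']
      refine le_trans (Finset.sum_le_sum fun g _ => ?_) (hn ⟨0, hn0⟩ rfl)
      have hp := ua_paper_nonneg (θ n) (hθ0 n) (hθ1 n) g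
      split_ifs with h1 h2 h2
      · exact le_rfl
      · exact absurd (ua_kthMax _ _ _ h1) h2
      · exact hp
      · exact le_rfl
  · refine ⟨4/5, by norm_num, fun ε hε hε1 η' hη' => ⟨3 * ε⁻¹, ?_⟩⟩
    apply ua_limsup_le
    · intro n
      split_ifs with h
      · exact le_rfl
      · refine Finset.sum_nonneg fun g _ => ?_
        split_ifs
        · exact ua_paper_nonneg _ (hθ0 n) (hθ1 n) g
        · exact le_rfl
    · filter_upwards [ua_asymp θ hθ0 hθ1 hθ (1/2) (by norm_num) (4/5) (by norm_num) (by norm_num)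
        (ε * η') (by positivity), Filter.eventually_gt_atTop 0] with n hn hn0
      rw [dif_neg hn0.ne']
      letI : NeZero n := ⟨hn0.ne'⟩
      have hL := ua_Lbound_pos (4/5) (1/2) n hn0 (by norm_num)
      set k := ⌈Lbound (4/5) n (1/2)⌉₊ with hk
      have hk0 : 0 < k := Nat.ceil_pos.2 hL
      have hb := ua_bayes (n := n) (θ n) (hθ0 n) (hθ1 n) ε k
      have hn' := hn (0 : Fin n) rfl
      have hfin : ε * ∑ g : SimpleGraph (Fin n),
          (if ∑ u ∈ uaC k g, postRoot n 1 0 (θ n) g u < 1 - ε then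
            paperProb n 1 0 (θ n) g else 0) ≤ ε * η' := by
        refine hb.trans (le_trans (Finset.sum_le_sum fun g _ => ?_) hn')
        have hp := ua_paper_nonneg (θ n) (hθ0 n) (hθ1 n) g
        by_cases h1 : (0 : Fin n) ∈ uaC k g
        · rw [if_pos h1]
          split_ifs
          · exact hp
          · exact le_rfl
        · rw [if_neg h1, if_pos]
          right
          rw [ua_mem_C, not_lt] at h1
          exact h1
      have hfin' := le_of_mul_le_mul_left hfin hε
      refine le_trans (Finset.sum_le_sum fun g _ => ?_) hfin'
      have hp := ua_paper_nonneg (θ n) (hθ0 n) (hθ1 n) g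
      by_cases h1 : ∑ u ∈ uaC k g, postRoot n 1 0 (θ n) g u < 1 - ε
      · rw [if_pos h1]
        split_ifs
        · exact le_rfl
        · exact hp
      · rw [if_neg h1, if_neg]
        rw [not_lt] at h1 ⊢
        rw [← ua_psi_comap (θ n) k g (ρ n).symm] at h1
        have h2 := ua_cred_le (θ n) ε _ _ h1
        have h3 := ua_C_card k hk0 (g.comap ⇑(ρ n).symm)
        have h4 : ((uaC k (g.comap ⇑(ρ n).symm)).card : ℝ) < Lbound (4/5) n (1/2) :=
          Nat.lt_ceil.1 h3
        have h5 : (credSize n 1 0 (θ n) ε (g.comap ⇑(ρ n).symm) : ℝ) ≤ 3 * (n:ℝ) ^ (4/5 : ℝ) :=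
          (Nat.cast_le.2 h2).trans (h4.le.trans (ua_Lbound_le n hn0))
        have hnp : (0:ℝ) < n := by exact_mod_cast hn0
        have h6 : (n:ℝ) ^ (-(4/5) : ℝ) * (n:ℝ) ^ (4/5 : ℝ) = 1 := by
          rw [← Real.rpow_add hnp]; norm_num
        calc _ ≤ (n:ℝ) ^ (-(4/5) : ℝ) * ε⁻¹ * (3 * (n:ℝ) ^ (4/5 : ℝ)) :=
              mul_le_mul_of_nonneg_left h5 (by positivity)
          _ = 3 * ε⁻¹ * ((n:ℝ) ^ (-(4/5) : ℝ) * (n:ℝ) ^ (4/5 : ℝ)) := by ring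
          _ = 3 * ε⁻¹ := by rw [h6, mul_one]
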